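/- Anti-divergence operator on the torus: Let d ≥ 2. There exists a linear operator 𝓡 mapping smooth mean-zero vector fields v : 𝕋^d → ℝ^d to smooth symmetric trace-free matrix fields 𝓡v : 𝕋^d → ℝ^{d×d} such that: (i) div(𝓡v) = v for every smooth mean-zero v (componentwise Σ_j ∂_j (𝓡v)_{ij} = v_i); (ii) if in addition div v = 0, then 𝓡(Δv) = ∇v + (∇v)ᵀ; (iii) for every p ∈ [1, ∞] there is a constant C_p > 0 with ‖𝓡v‖_{L^p(𝕋^d)} ≤ C_p ‖v‖_{L^p(𝕋^d)} for all smooth mean-zero v; (iv) for every p ∈ [1, ∞] there is a constant C_p′ > 0 such that for every smooth mean-zero f : 𝕋^d → ℝ^d and every σ ∈ ℕ, ‖𝓡(f(σ·))‖_{L^p(𝕋^d)} ≤ C_p′ σ^{−1} ‖f‖_{L^p(𝕋^d)}. -/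

import Mathlib

noncomputable section

open MeasureTheory ENNReal

/-- The unit cube in `ℝ^d`, a fundamental domain for the torus `𝕋^d = ℝ^d/ℤ^d`. -/
def cube (d : ℕ) : Set (Fin d → ℝ) := Set.Icc 0 1

/-- A function on `ℝ^d` is `ℤ^d`-periodic, i.e. descends to the torus `𝕋^d`. -/
def ZPeriodic {d : ℕ} {E : Type*} (f : (Fin d → ℝ) → E) : Prop :=
  ∀ (x : Fin d → ℝ) (k : Fin d → ℤ), f (fun i => x i + (k i : ℝ)) = f x

/-- Partial derivative `∂_j g` of a real-valued function on `ℝ^d`. -/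
def pd {d : ℕ} (j : Fin d) (g : (Fin d → ℝ) → ℝ) (x : Fin d → ℝ) : ℝ :=
  fderiv ℝ g x (Pi.single j 1)

/-- A smooth mean-zero vector field on the torus `𝕋^d`. -/
def SmoothMeanZeroField (d : ℕ) (v : (Fin d → ℝ) → Fin d → ℝ) : Prop :=
  ContDiff ℝ (⊤ : ℕ∞) v ∧ ZPeriodic v ∧ ∀ i, (∫ x in cube d, v x i) = 0

/-- Componentwise Laplacian of a vector field on `ℝ^d`. -/
def lap {d : ℕ} (v : (Fin d → ℝ) → Fin d → ℝ) : (Fin d → ℝ) → Fin d → ℝ :=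
  fun x i => ∑ j, pd j (fun y => pd j (fun z => v z i) y) x

/-- projection to the torus -/
def toT {d : ℕ} (x : Fin d → ℝ) : UnitAddTorus (Fin d) := fun i => (x i : UnitAddCircle)

lemma mp_toT (d : ℕ) : MeasurePreserving (toT (d := d)) (volume.restrict (cube d)) volume := by
  have h := measurePreserving_pi (fun _ : Fin d => (volume : Measure ℝ).restrict (Set.Ioc 0 (0+1)))
    (fun _ => (volume : Measure UnitAddCircle)) (fun i => UnitAddCircle.measurePreserving_mk 0)
  rw [← Measure.restrict_pi_pi] at h
  have e : (Measure.pi fun _ : Fin d => (volume : Measure ℝ)).restrict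
      (Set.univ.pi fun _ => Set.Ioc (0:ℝ) (0+1)) = volume.restrict (cube d) := by
    refine Measure.restrict_congr_set ?_
    have := Measure.univ_pi_Ioc_ae_eq_Icc (μ := fun _ : Fin d => (volume : Measure ℝ))
      (f := 0) (g := 1)
    simpa [cube] using this
  rw [e] at h
  exact h

lemma oq_toT (d : ℕ) : IsOpenQuotientMap (toT (d := d)) := by
  have : toT (d := d) = Pi.map (fun _ : Fin d => ((↑) : ℝ → UnitAddCircle)) := rfl
  rw [this]
  exact IsOpenQuotientMap.piMap (fun _ => QuotientAddGroup.isOpenQuotientMap_mk)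

lemma exists_lift {d : ℕ} {E : Type*} [TopologicalSpace E] {f : (Fin d → ℝ) → E}
    (hf : Continuous f) (hp : ZPeriodic f) :
    ∃ F : UnitAddTorus (Fin d) → E, Continuous F ∧ ∀ x, F (toT x) = f x := by
  have key : ∀ x y : Fin d → ℝ, toT x = toT y → f x = f y := by
    intro x y h
    have : ∀ i, ∃ n : ℤ, x i = y i + n := by
      intro i
      have := congrFun h i
      simp only [toT] at this
      obtain ⟨n, hn⟩ := AddSubgroup.mem_zmultiples_iff.1 (QuotientAddGroup.eq.1 this.symm)
      exact ⟨n, by simp at hn; linarith⟩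
    choose n hn using this
    have := hp y n
    rw [← this]
    congr 1
    ext i; exact hn i
  refine ⟨fun t => f (Function.surjInv (oq_toT d).surjective t), ?_, ?_⟩
  · rw [(oq_toT d).isQuotientMap.continuous_iff]
    convert hf using 1
    ext x
    exact key _ _ (Function.surjInv_eq _ _)
  · intro x
    exact key _ _ (Function.surjInv_eq _ _)

lemma toT_sub {d : ℕ} (x y : Fin d → ℝ) : toT (x - y) = toT x - toT y := rfl

lemma lint_shift {d : ℕ} {f : (Fin d → ℝ) → ℝ≥0∞} (hf : Continuous f) (hp : ZPeriodic f)
    (y : Fin d → ℝ) : ∫⁻ x in cube d, f (x - y) = ∫⁻ x in cube d, f x := by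
  obtain ⟨F, hF, h⟩ := exists_lift hf hp
  simp only [← h, toT_sub]
  rw [(mp_toT d).lintegral_comp (f := fun t => F (t - toT y)) (by fun_prop),
    (mp_toT d).lintegral_comp hF.measurable]
  exact lintegral_sub_right_eq_self F (toT y)

lemma mp_smul (d : ℕ) (σ : ℕ) (hσ : 0 < σ) :
    MeasurePreserving (fun t : UnitAddTorus (Fin d) => fun i => σ • t i) volume volume := by
  refine volume_preserving_pi (f := fun _ (t : UnitAddCircle) => σ • t) (fun i => ?_)
  have := MeasureTheory.Measure.measurePreserving_zsmul (volume : Measure UnitAddCircle) (n := (σ : ℤ)) (by omega)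
  simpa using this

lemma toT_smul {d : ℕ} (σ : ℕ) (x : Fin d → ℝ) : toT ((σ : ℝ) • x) = fun i => σ • toT x i := by
  ext i
  simp [toT]

lemma eLp_scale {d : ℕ} {E : Type*} [NormedAddCommGroup E]
    {f : (Fin d → ℝ) → E} (hf : Continuous f) (hp : ZPeriodic f) (σ : ℕ) (hσ : 0 < σ) (p : ℝ≥0∞) :
    eLpNorm (fun x => f ((σ : ℝ) • x)) p (volume.restrict (cube d)) =
      eLpNorm f p (volume.restrict (cube d)) := by
  -- norms suffice
  suffices H : ∀ g : (Fin d → ℝ) → ℝ, Continuous g → ZPeriodic g →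
      eLpNorm (fun x => g ((σ : ℝ) • x)) p (volume.restrict (cube d)) =
      eLpNorm g p (volume.restrict (cube d)) by
    have := H (fun x => ‖f x‖) hf.norm (fun x k => by simp only [hp x k])
    rwa [eLpNorm_norm (fun x => f ((σ : ℝ) • x)), eLpNorm_norm f] at this
  clear hf hp f
  intro f hf hp
  obtain ⟨F, hF, h⟩ := exists_lift hf hp
  simp only [← h, toT_smul]
  have e : f = fun x => F (toT x) := by ext x; rw [h]
  have h1 := eLpNorm_comp_measurePreserving (p := p) (g := F) hF.aestronglyMeasurable (mp_toT d)
  have h2 := eLpNorm_comp_measurePreserving (p := p) (g := F) hF.aestronglyMeasurable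
    ((mp_smul d σ hσ).comp (mp_toT d))
  rw [e]
  exact h2.trans h1.symm

lemma int_scale {d : ℕ} {f : (Fin d → ℝ) → ℝ} (hf : Continuous f) (hp : ZPeriodic f)
    (σ : ℕ) (hσ : 0 < σ) :
    ∫ x in cube d, f ((σ : ℝ) • x) = ∫ x in cube d, f x := by
  obtain ⟨F, hF, h⟩ := exists_lift hf hp
  simp only [← h, toT_smul]
  have key : ∀ φ : (Fin d → ℝ) → UnitAddTorus (Fin d),
      MeasurePreserving φ (volume.restrict (cube d)) volume →
      ∫ x in cube d, F (φ x) = ∫ t, F t := by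
    intro φ hφ
    rw [← hφ.map_eq, integral_map hφ.measurable.aemeasurable hF.aestronglyMeasurable]
  rw [key _ (mp_toT d)]
  exact key _ ((mp_smul d σ hσ).comp (mp_toT d))

lemma le_of_linfty {d : ℕ} {f : (Fin d → ℝ) → ℝ} (hf : Continuous f) (hp : ZPeriodic f)
    (x : Fin d → ℝ) : ‖f x‖ₑ ≤ eLpNorm f ∞ (volume.restrict (cube d)) := by
  obtain ⟨F, hF, h⟩ := exists_lift hf hp
  have e : f = F ∘ toT := by ext x; simp [h]
  have h1 := eLpNorm_comp_measurePreserving (p := ∞) (g := F) hF.aestronglyMeasurable (mp_toT d)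
  rw [e, h1]
  have h2 : ∀ᵐ t, ‖F t‖ₑ ≤ eLpNorm F ∞ volume := by
    rw [eLpNorm_exponent_top]; exact ae_le_eLpNormEssSup
  have h3 : {t | ¬ ‖F t‖ₑ ≤ eLpNorm F ∞ volume} = ∅ := by
    refine IsOpen.eq_empty_of_measure_zero (μ := volume) ?_ (ae_iff.1 h2)
    simp only [not_le]
    exact isOpen_lt continuous_const hF.enorm
  by_contra hh
  have : toT x ∈ {t | ¬ ‖F t‖ₑ ≤ eLpNorm F ∞ volume} := hh
  rw [h3] at this
  exact this

lemma ker_Lp {d : ℕ} {Ω : Type*} [MeasurableSpace Ω] (μ : Measure Ω) [SFinite μ]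
    {W : Ω → ℂ} (hW : Integrable W μ) {Y : Ω → Fin d → ℝ} (hY : Measurable Y)
    {g : (Fin d → ℝ) → ℝ} (hg : Continuous g) (hp : ZPeriodic g) (p : ℝ≥0∞) (h1 : 1 ≤ p) :
    eLpNorm (fun x => ∫ ω, ‖W ω‖ * ‖g (x - Y ω)‖ ∂μ) p (volume.restrict (cube d))
      ≤ ENNReal.ofReal (∫ ω, ‖W ω‖ ∂μ) * eLpNorm g p (volume.restrict (cube d)) := by
  set ν := μ.withDensity (fun ω => ‖W ω‖ₑ) with hν
  have hWm : AEMeasurable (fun ω => ‖W ω‖ₑ) μ := hW.1.enorm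
  have huniv : ENNReal.ofReal (∫ ω, ‖W ω‖ ∂μ) = ν Set.univ := by
    rw [hν, withDensity_apply _ MeasurableSet.univ, Measure.restrict_univ,
      ofReal_integral_norm_eq_lintegral_enorm hW]
  rw [huniv]
  have hgY : ∀ x, Measurable (fun ω => g (x - Y ω)) := fun x =>
    hg.measurable.comp (measurable_const.sub hY)
  have hb : ∀ x, ‖∫ ω, ‖W ω‖ * ‖g (x - Y ω)‖ ∂μ‖ₑ ≤ ∫⁻ ω, ‖g (x - Y ω)‖ₑ ∂ν := by
    intro x
    refine (enorm_integral_le_lintegral_enorm _).trans ?_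
    rw [hν, lintegral_withDensity_eq_lintegral_mul₀ hWm (hgY x).enorm.aemeasurable]
    simp [enorm_mul]
  have hsf : SFinite ν := by infer_instance
  by_cases hp' : p = ∞
  · subst hp'
    rw [eLpNorm_exponent_top]
    refine essSup_le_of_ae_le _ (Filter.Eventually.of_forall fun x => ?_)
    refine (hb x).trans ?_
    refine (lintegral_mono (fun ω => le_of_linfty hg hp (x - Y ω))).trans ?_
    rw [lintegral_const, mul_comm]
  · have p0 : p ≠ 0 := (zero_lt_one.trans_le h1).ne'
    have pr1 : 1 ≤ p.toReal := by
      simpa using ENNReal.toReal_mono hp' h1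
    have pr : 0 < p.toReal := by linarith
    rw [eLpNorm_eq_lintegral_rpow_enorm_toReal p0 hp', eLpNorm_eq_lintegral_rpow_enorm_toReal p0 hp']
    set r := p.toReal with hr
    have step : ∀ x, ‖∫ ω, ‖W ω‖ * ‖g (x - Y ω)‖ ∂μ‖ₑ ^ r ≤
        (ν Set.univ) ^ (r - 1) * ∫⁻ ω, ‖g (x - Y ω)‖ₑ ^ r ∂ν := by
      intro x
      have h := eLpNorm_le_eLpNorm_mul_rpow_measure_univ (μ := ν) h1
        (hgY x).aestronglyMeasurable
      rw [eLpNorm_one_eq_lintegral_enorm, eLpNorm_eq_lintegral_rpow_enorm_toReal p0 hp', ← hr] at h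
      have h' := ENNReal.rpow_le_rpow ((hb x).trans h) pr.le
      refine h'.trans (le_of_eq ?_)
      rw [ENNReal.mul_rpow_of_nonneg _ _ pr.le, ← ENNReal.rpow_mul, ← ENNReal.rpow_mul, mul_comm]
      congr 2
      · simp; field_simp
      · field_simp; simp
    have hjoint : AEMeasurable (Function.uncurry fun (x : Fin d → ℝ) (ω : Ω) => ‖g (x - Y ω)‖ₑ ^ r)
        ((volume.restrict (cube d)).prod ν) := by
      refine Measurable.aemeasurable ?_
      refine Measurable.pow_const ?_ r
      exact (hg.measurable.comp (measurable_fst.sub (hY.comp measurable_snd))).enorm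
    have tot : ∫⁻ x in cube d, ‖∫ ω, ‖W ω‖ * ‖g (x - Y ω)‖ ∂μ‖ₑ ^ r ≤
        (ν Set.univ) ^ r * ∫⁻ x in cube d, ‖g x‖ₑ ^ r := by
      refine (lintegral_mono step).trans ?_
      have hfin : ν Set.univ ≠ ∞ := by rw [← huniv]; exact ENNReal.ofReal_ne_top
      rw [lintegral_const_mul' _ _ (ENNReal.rpow_ne_top_of_nonneg (by linarith) hfin),
        lintegral_lintegral_swap hjoint]
      have hc : Continuous (fun x => ‖g x‖ₑ ^ r) :=
        (ENNReal.continuous_rpow_const).comp hg.enorm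
      have : ∀ ω, ∫⁻ x in cube d, ‖g (x - Y ω)‖ₑ ^ r = ∫⁻ x in cube d, ‖g x‖ₑ ^ r := fun ω =>
        lint_shift hc (fun x k => by simp only [hp x k]) (Y ω)
      simp only [this]
      rw [lintegral_const, mul_comm (∫⁻ x in cube d, ‖g x‖ₑ ^ r), ← mul_assoc]
      refine mul_le_mul_left ?_ _
      by_cases h0 : ν Set.univ = 0
      · simp [h0]
      · have := ENNReal.rpow_add (r - 1) 1 h0 hfin
        rw [sub_add_cancel, ENNReal.rpow_one] at this
        rw [this]
    refine (ENNReal.rpow_le_rpow tot (by positivity)).trans (le_of_eq ?_)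
    rw [ENNReal.mul_rpow_of_nonneg _ _ (by positivity), ← ENNReal.rpow_mul]
    congr 1
    rw [mul_one_div_cancel pr.ne', ENNReal.rpow_one]

section
open scoped FourierTransform SchwartzMap

/-- the character `e^{2π i k·x}` -/
def ee {d : ℕ} (k : Fin d → ℤ) (x : Fin d → ℝ) : ℂ :=
  Complex.exp (2 * Real.pi * Complex.I * ((∑ j, (k j : ℝ) * x j : ℝ) : ℂ))

lemma norm_ee {d : ℕ} (k : Fin d → ℤ) (x : Fin d → ℝ) : ‖ee k x‖ = 1 := by
  rw [ee, show (2 * Real.pi * Complex.I * ((∑ j, (k j : ℝ) * x j : ℝ) : ℂ)) =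
    ((2 * Real.pi * ∑ j, (k j : ℝ) * x j : ℝ) : ℂ) * Complex.I by push_cast; ring]
  exact Complex.norm_exp_ofReal_mul_I _

lemma ee_sub {d : ℕ} (k : Fin d → ℤ) (x y : Fin d → ℝ) : ee k (x - y) = ee k x * ee k (-y) := by
  rw [ee, ee, ee, ← Complex.exp_add]
  congr 1
  rw [← mul_add, ← Complex.ofReal_add, ← Finset.sum_add_distrib]
  congr 3
  ext j; simp; ring

lemma ee_smul {d : ℕ} (k : Fin d → ℤ) (σ : ℕ) (x : Fin d → ℝ) :
    ee k ((σ : ℝ) • x) = ee (fun j => σ * k j) x := by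
  rw [ee, ee]
  congr 4
  ext j; simp; ring

lemma continuous_ee {d : ℕ} (k : Fin d → ℤ) : Continuous (ee k) := by
  unfold ee; fun_prop

/-- The index measure space of all kernels. -/
abbrev KerIdx (d : ℕ) := ℕ × EuclideanSpace ℝ (Fin d)

/-- Its measure. -/
def kerMu (d : ℕ) : Measure (KerIdx d) := (Measure.count : Measure ℕ).prod volume

instance (d : ℕ) : SFinite (kerMu d) := by unfold kerMu; infer_instance

lemma exists_psi (d : ℕ) : ∃ ψ : EuclideanSpace ℝ (Fin d) → ℝ, ContDiff ℝ ((⊤ : ℕ∞) : WithTop ℕ∞) ψ ∧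
    (∀ ξ, ‖ξ‖ ≤ 1/2 → ψ ξ = 0) ∧ (∀ ξ, 2 ≤ ‖ξ‖ → ψ ξ = 0) ∧
    (∀ ξ, 1 ≤ ‖ξ‖ → HasSum (fun n : ℕ => ψ ((1/2 : ℝ)^n • ξ)) 1) := by
  let f : ContDiffBump (0 : EuclideanSpace ℝ (Fin d)) := ⟨1, 2, by norm_num, by norm_num⟩
  have f1 : ∀ ξ, ‖ξ‖ ≤ 1 → f ξ = 1 := fun ξ h => f.one_of_mem_closedBall (by simpa using h)
  have f0 : ∀ ξ, 2 ≤ ‖ξ‖ → f ξ = 0 := fun ξ h => f.zero_of_le_dist (by simpa using h)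
  have hz : ∀ ξ, ‖ξ‖ ≤ 1/2 → f ξ - f ((2:ℝ) • ξ) = 0 := by
    intro ξ h
    rw [f1 ξ (by linarith), f1 _ (by rw [norm_smul]; norm_num; linarith), sub_self]
  refine ⟨fun ξ => f ξ - f ((2:ℝ) • ξ), ?_, hz, ?_, ?_⟩
  · exact f.contDiff.sub (f.contDiff.comp (contDiff_const_smul _))
  · intro ξ h
    beta_reduce
    rw [f0 ξ h, f0 _ (by rw [norm_smul]; norm_num; linarith), sub_self]
  · intro ξ h
    obtain ⟨N, hN⟩ := exists_pow_lt_of_lt_one (show (0:ℝ) < (1/2)/ ‖ξ‖ by positivity)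
      (show (1/2 : ℝ) < 1 by norm_num)
    have hN' : ∀ n, N ≤ n → ‖(1/2 : ℝ)^n • ξ‖ ≤ 1/2 := by
      intro n hn
      rw [norm_smul, norm_pow]
      have : (1/2:ℝ)^n ≤ (1/2)^N := pow_le_pow_of_le_one (by norm_num) (by norm_num) hn
      have h2 : (1/2:ℝ)^N * ‖ξ‖ ≤ 1/2 := by
        rw [lt_div_iff₀ (by linarith)] at hN; exact hN.le
      norm_num at this h2 ⊢
      nlinarith [norm_nonneg ξ]
    have hs := hasSum_sum_of_ne_finset_zero (L := SummationFilter.unconditional ℕ) (f := fun n : ℕ =>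
      f ((1/2 : ℝ)^n • ξ) - f ((2:ℝ) • (1/2 : ℝ)^n • ξ)) (s := Finset.range N) (by
        intro n hn
        exact hz _ (hN' n (by simpa using hn)))
    convert hs using 1
    have : ∀ n : ℕ, f ((1/2 : ℝ)^n • ξ) - f ((2:ℝ) • (1/2 : ℝ)^n • ξ) =
      (fun m : ℕ => f ((2 * (1/2 : ℝ)^m) • ξ)) (n+1) - (fun m : ℕ => f ((2 * (1/2 : ℝ)^m) • ξ)) n := by
      intro n
      simp only [smul_smul]
      congr 3
      ring
    simp only [this]
    rw [Finset.sum_range_sub (fun m : ℕ => f ((2 * (1/2 : ℝ)^m) • ξ))]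
    rw [f0 ((2 * (1/2:ℝ)^0) • ξ) (by rw [norm_smul]; norm_num; linarith), f1, sub_zero]
    have := hN' N le_rfl
    rw [mul_smul, norm_smul]
    norm_num at this ⊢
    linarith

/-- integer vectors as Euclidean vectors -/
def iv {d : ℕ} (k : Fin d → ℤ) : EuclideanSpace ℝ (Fin d) := WithLp.toLp 2 (fun j => (k j : ℝ))

lemma one_le_norm_iv {d : ℕ} (k : Fin d → ℤ) (hk : k ≠ 0) : 1 ≤ ‖iv k‖ := by
  obtain ⟨j, hj⟩ := Function.ne_iff.1 hk
  have h1 : ‖(iv k) j‖ ≤ ‖iv k‖ := PiLp.norm_apply_le _ j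
  refine le_trans ?_ h1
  simp only [iv, Real.norm_eq_abs]
  have : (1:ℤ) ≤ |k j| := Int.one_le_abs hj
  exact_mod_cast this

lemma exists_ker {d : ℕ} (m : EuclideanSpace ℝ (Fin d) → ℂ)
    (hm : ∀ ξ, ξ ≠ 0 → ContDiffAt ℝ ((⊤ : ℕ∞) : WithTop ℕ∞) m ξ) (h0 : m 0 = 0)
    (hom : ∀ t : ℝ, 0 < t → ∀ ξ, m (t • ξ) = (t : ℂ)⁻¹ * m ξ) :
    ∃ (W : KerIdx d → ℂ) (Y : KerIdx d → Fin d → ℝ), Integrable W (kerMu d) ∧ Measurable Y ∧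
      ∀ k : Fin d → ℤ, ∫ ω, W ω * ee k (-(Y ω)) ∂(kerMu d) = m (iv k) := by
  obtain ⟨ψ, hψ, hψ0, hψ2, hψs⟩ := exists_psi d
  let η : EuclideanSpace ℝ (Fin d) → ℂ := fun ξ => (ψ ξ : ℂ) * m ξ
  have hη : ContDiff ℝ ((⊤ : ℕ∞) : WithTop ℕ∞) η := by
    rw [contDiff_iff_contDiffAt]
    intro ξ
    by_cases h : ξ = 0
    · subst h
      have : η =ᶠ[nhds 0] fun _ => 0 := by
        filter_upwards [Metric.closedBall_mem_nhds (0 : EuclideanSpace ℝ (Fin d))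
          (show (0:ℝ) < 1/2 by norm_num)] with ξ hξ
        simp only [η]
        rw [hψ0 ξ (by simpa using hξ)]; simp
      exact contDiffAt_const.congr_of_eventuallyEq this
    · exact (Complex.ofRealCLM.contDiff.comp hψ).contDiffAt.mul (hm ξ h)
  have hηc : HasCompactSupport η := by
    refine HasCompactSupport.intro (isCompact_closedBall 0 2) (fun ξ hξ => ?_)
    simp only [η]
    rw [hψ2 ξ (by simp at hξ; exact hξ.le)]; simp
  let H : 𝓢(EuclideanSpace ℝ (Fin d), ℂ) := hηc.toSchwartzMap hη
  let h : 𝓢(EuclideanSpace ℝ (Fin d), ℂ) := 𝓕⁻ H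
  have hF : ∀ ξ, 𝓕 (h : EuclideanSpace ℝ (Fin d) → ℂ) ξ = η ξ := by
    intro ξ
    rw [← SchwartzMap.fourier_coe]
    have : 𝓕 h = H := FourierTransform.fourier_fourierInv_eq H
    rw [this]; rfl
  have hgeo : Integrable (fun n : ℕ => (1/2 : ℂ)^n) Measure.count := by
    rw [integrable_count_iff]
    simp only [norm_pow]
    exact summable_geometric_of_lt_one (by positivity) (by norm_num)
  have hWi : Integrable (fun ω : KerIdx d => (1/2 : ℂ)^ω.1 * h ω.2) (kerMu d) :=
    hgeo.mul_prod h.integrable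
  refine ⟨fun ω => (1/2 : ℂ)^ω.1 * h ω.2, fun ω j => (1/2 : ℝ)^ω.1 * ω.2 j, hWi, ?_, ?_⟩
  · refine measurable_pi_lambda _ fun j => ?_
    refine Measurable.mul ?_ ?_
    · exact (measurable_from_top (f := fun n : ℕ => (1/2:ℝ)^n)).comp measurable_fst
    · exact ((EuclideanSpace.proj j : EuclideanSpace ℝ (Fin d) →L[ℝ] ℝ).continuous.measurable).comp
        measurable_snd
  · intro k
    have hYm : Measurable (fun ω : KerIdx d => fun j => -((1/2 : ℝ)^ω.1 * ω.2 j)) := by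
      refine measurable_pi_lambda _ fun j => ?_
      refine Measurable.neg (Measurable.mul ?_ ?_)
      · exact (measurable_from_top (f := fun n : ℕ => (1/2:ℝ)^n)).comp measurable_fst
      · exact ((EuclideanSpace.proj j : EuclideanSpace ℝ (Fin d) →L[ℝ] ℝ).continuous.measurable).comp
          measurable_snd
    have hIntg : Integrable (fun ω : KerIdx d => (1/2 : ℂ)^ω.1 * h ω.2 *
        ee k (-(fun j => (1/2 : ℝ)^ω.1 * ω.2 j))) (kerMu d) := by
      refine hWi.mul_bdd (c := 1) ?_ ?_
      · exact ((continuous_ee k).measurable.comp hYm).aestronglyMeasurable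
      · exact Filter.Eventually.of_forall fun ω => (norm_ee _ _).le
    have hn : ∀ n : ℕ, ∫ z, (1/2 : ℂ)^n * h z * ee k (-(fun j => (1/2 : ℝ)^n * z j)) =
        (ψ ((1/2:ℝ)^n • iv k) : ℂ) * m (iv k) := by
      intro n
      have e1 : ∫ z, (1/2 : ℂ)^n * h z * ee k (-(fun j => (1/2 : ℝ)^n * z j)) =
          (1/2 : ℂ)^n * η ((1/2:ℝ)^n • iv k) := by
        rw [← hF, Real.fourier_eq', ← integral_const_mul]
        congr 1
        ext z
        rw [smul_eq_mul, mul_assoc, mul_comm (h z)]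
        congr 2
        rw [ee]
        congr 1
        simp only [PiLp.inner_apply, iv, Pi.neg_apply]
        push_cast
        simp only [Finset.mul_sum, Finset.sum_mul]
        refine Finset.sum_congr rfl fun j _ => ?_
        simp
        ring
      rw [e1]
      simp only [η]
      rw [hom _ (by positivity)]
      push_cast
      have : ((1/2:ℂ)^n) ≠ 0 := pow_ne_zero _ (by norm_num)
      field_simp
    unfold kerMu at hIntg ⊢
    rw [integral_prod _ hIntg]
    simp only [hn]
    have hIntg2 := hIntg.integral_prod_left
    simp only [hn] at hIntg2
    rw [integral_countable hIntg2]
    simp only [Measure.real, Measure.count_singleton, ENNReal.toReal_one, one_smul]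
    by_cases hk : k = 0
    · have : iv k = 0 := by subst hk; ext j; simp [iv]
      simp [this, h0]
    · have := (Complex.hasSum_ofReal.2 (hψs _ (one_le_norm_iv k hk))).mul_right (m (iv k))
      simpa using this.tsum_eq
end

lemma sum_int (d : ℕ) : Summable (fun k : Fin d → ℤ => ∏ j, (1 + (k j : ℝ)^2)⁻¹) := by
  induction d with
  | zero => exact Summable.of_finite
  | succ n ih =>
    have h1 : Summable (fun m : ℤ => (1 + (m : ℝ)^2)⁻¹) := by
      have h2 : Summable (fun m : ℤ => 1 / (m : ℝ)^2) :=
        Real.summable_one_div_int_pow.2 (by norm_num)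
      refine Summable.of_norm_bounded_eventually h2 ?_
      have : ∀ᶠ m : ℤ in Filter.cofinite, m ≠ 0 := by
        exact Filter.eventually_cofinite_ne 0
      filter_upwards [this] with m hm
      have hm' : (m : ℝ) ≠ 0 := by exact_mod_cast hm
      rw [Real.norm_of_nonneg (by positivity), one_div]
      gcongr
      linarith
    have h3 := h1.mul_of_nonneg ih (fun m => by positivity) (fun k => by
      simp only [Pi.zero_apply]; exact Finset.prod_nonneg fun j _ => by positivity)
    rw [← (Fin.consEquiv (fun _ => ℤ)).summable_iff]
    refine h3.congr fun x => ?_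
    simp [Fin.prod_univ_succ, Fin.consEquiv]
    ring

/-- weight -/
def wt {d : ℕ} (k : Fin d → ℤ) : ℝ := 1 + ∑ j, |(k j : ℝ)|

lemma one_le_wt {d : ℕ} (k : Fin d → ℤ) : 1 ≤ wt k := by
  have : 0 ≤ ∑ j, |(k j : ℝ)| := Finset.sum_nonneg fun j _ => abs_nonneg _
  unfold wt; linarith

lemma abs_le_wt {d : ℕ} (k : Fin d → ℤ) (j : Fin d) : |(k j : ℝ)| ≤ wt k := by
  have := Finset.single_le_sum (f := fun j => |(k j : ℝ)|) (fun j _ => abs_nonneg _)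
    (Finset.mem_univ j)
  unfold wt; linarith

/-- rapidly decaying coefficients -/
def RD {d : ℕ} (a : (Fin d → ℤ) → ℂ) : Prop := ∀ N : ℕ, Summable (fun k => ‖a k‖ * wt k ^ N)

lemma RD.of_bound {d : ℕ} {a : (Fin d → ℤ) → ℂ}
    (h : ∀ N : ℕ, ∃ C : ℝ, ∀ k, ‖a k‖ * wt k ^ N ≤ C) : RD a := by
  intro N
  obtain ⟨C, hC⟩ := h (N + 2 * d)
  have hC0 : 0 ≤ C := le_trans (mul_nonneg (norm_nonneg _)
    (pow_nonneg (zero_le_one.trans (one_le_wt 0)) _)) (hC 0)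
  refine Summable.of_nonneg_of_le (fun k => ?_) (fun k => ?_) ((sum_int d).mul_left C)
  · exact mul_nonneg (norm_nonneg _) (pow_nonneg (zero_le_one.trans (one_le_wt k)) _)
  · have h1 := one_le_wt k
    have hw : 0 < wt k ^ (2 * d) := by positivity
    have h2 : (wt k ^ (2*d))⁻¹ ≤ ∏ j, (1 + (k j : ℝ)^2)⁻¹ := by
      rw [Finset.prod_inv_distrib]
      refine inv_anti₀ (Finset.prod_pos fun j _ => by positivity) ?_
      have : ∏ j : Fin d, (1 + (k j : ℝ)^2) ≤ ∏ j : Fin d, wt k ^ 2 := by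
        refine Finset.prod_le_prod (fun j _ => by positivity) (fun j _ => ?_)
        have h3 : 1 + |(k j : ℝ)| ≤ wt k := by
          have := Finset.single_le_sum (f := fun j => |(k j : ℝ)|) (fun j _ => abs_nonneg _)
            (Finset.mem_univ j)
          unfold wt; linarith
        rw [← sq_abs]
        nlinarith [abs_nonneg (k j : ℝ)]
      refine this.trans (le_of_eq ?_)
      simp [pow_mul]
    calc ‖a k‖ * wt k ^ N = (‖a k‖ * wt k ^ (N + 2 * d)) * (wt k ^ (2*d))⁻¹ := by
          rw [pow_add]; field_simp
      _ ≤ C * ∏ j, (1 + (k j : ℝ)^2)⁻¹ := by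
          refine mul_le_mul (hC k) h2 (by positivity) hC0

lemma RD.mul {d : ℕ} {a : (Fin d → ℤ) → ℂ} (ha : RD a) {b : (Fin d → ℤ) → ℂ} (C : ℝ) (M : ℕ)
    (hb : ∀ k, ‖b k‖ ≤ C * wt k ^ M) : RD (fun k => b k * a k) := by
  intro N
  refine Summable.of_nonneg_of_le (fun k => ?_) (fun k => ?_) ((ha (M + N)).mul_left C)
  · exact mul_nonneg (norm_nonneg _) (pow_nonneg (zero_le_one.trans (one_le_wt k)) _)
  · have h1 := one_le_wt k
    rw [norm_mul]
    calc ‖b k‖ * ‖a k‖ * wt k ^ N ≤ (C * wt k ^ M) * ‖a k‖ * wt k ^ N := by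
          gcongr; exact hb k
      _ = _ := by rw [pow_add]; ring

lemma RD.sum {d : ℕ} {ι : Type*} (s : Finset ι) {a : ι → (Fin d → ℤ) → ℂ} (ha : ∀ i, RD (a i)) :
    RD (fun k => ∑ i ∈ s, a i k) := by
  intro N
  refine Summable.of_nonneg_of_le (fun k => ?_) (fun k => ?_)
    (summable_sum (s := s) (fun i _ => ha i N))
  · exact mul_nonneg (norm_nonneg _) (pow_nonneg (zero_le_one.trans (one_le_wt k)) _)
  · rw [← Finset.sum_mul]
    have h1 := one_le_wt k
    gcongr
    exact norm_sum_le _ _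

lemma RD.summable_norm {d : ℕ} {a : (Fin d → ℤ) → ℂ} (ha : RD a) : Summable (fun k => ‖a k‖) := by
  simpa using ha 0

/-- the Fourier series -/
def FS {d : ℕ} (a : (Fin d → ℤ) → ℂ) (x : Fin d → ℝ) : ℂ := ∑' k, a k * ee k x

lemma RD.summable {d : ℕ} {a : (Fin d → ℤ) → ℂ} (ha : RD a) (x : Fin d → ℝ) :
    Summable (fun k => a k * ee k x) := by
  refine Summable.of_norm ?_
  simpa [norm_mul, norm_ee] using ha.summable_norm

lemma FS_sum {d : ℕ} {ι : Type*} (s : Finset ι) {a : ι → (Fin d → ℤ) → ℂ} (ha : ∀ i, RD (a i))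
    (x : Fin d → ℝ) : FS (fun k => ∑ i ∈ s, a i k) x = ∑ i ∈ s, FS (a i) x := by
  unfold FS
  simp only [Finset.sum_mul]
  exact Summable.tsum_finsetSum (fun i _ => (ha i).summable x)

/-- linear form `2π i k·y` -/
def lf {d : ℕ} (k : Fin d → ℤ) : (Fin d → ℝ) →L[ℝ] ℂ :=
  ∑ j, (ContinuousLinearMap.proj j : (Fin d → ℝ) →L[ℝ] ℝ).smulRight
    (2 * Real.pi * Complex.I * (k j : ℂ))

lemma lf_apply {d : ℕ} (k : Fin d → ℤ) (y : Fin d → ℝ) :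
    lf k y = 2 * Real.pi * Complex.I * ((∑ j, (k j : ℝ) * y j : ℝ) : ℂ) := by
  simp only [lf, sum_apply, ContinuousLinearMap.smulRight_apply,
    ContinuousLinearMap.proj_apply, Complex.real_smul]
  push_cast
  rw [Finset.mul_sum]
  exact Finset.sum_congr rfl fun j _ => by ring

lemma lf_norm {d : ℕ} (k : Fin d → ℤ) (y : Fin d → ℝ) :
    ‖lf k y‖ ≤ 2 * Real.pi * wt k * ‖y‖ := by
  rw [lf_apply, norm_mul]
  have e : ‖(2 * Real.pi * Complex.I : ℂ)‖ = 2 * Real.pi := by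
    simp [abs_of_pos Real.pi_pos]
  rw [e, Complex.norm_real, mul_assoc (2 * Real.pi)]
  refine mul_le_mul_of_nonneg_left ?_ (by positivity)
  calc ‖∑ j, (k j : ℝ) * y j‖ ≤ ∑ j, |(k j : ℝ)| * ‖y‖ := by
        refine norm_sum_le_of_le _ fun j _ => ?_
        rw [norm_mul]
        gcongr
        · exact le_rfl
        · exact norm_le_pi_norm y j
    _ = (∑ j, |(k j : ℝ)|) * ‖y‖ := by rw [Finset.sum_mul]
    _ ≤ wt k * ‖y‖ := by gcongr; unfold wt; linarith

lemma ee_hasFDerivAt {d : ℕ} (k : Fin d → ℤ) (x : Fin d → ℝ) :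
    HasFDerivAt (ee k) (ee k x • lf k) x := by
  have h := ((lf k).hasFDerivAt (x := x)).cexp
  have e : (fun y => Complex.exp (lf k y)) = ee k := by
    ext y; rw [lf_apply, ee]
  rw [e] at h
  have e2 : Complex.exp (lf k x) = ee k x := congrFun e x
  rwa [e2] at h

lemma FS_hasFDerivAt {d : ℕ} {a : (Fin d → ℤ) → ℂ} (ha : RD a) (x : Fin d → ℝ) :
    DifferentiableAt ℝ (FS a) x ∧ ∀ y, fderiv ℝ (FS a) x y = FS (fun k => lf k y * a k) x := by
  have hb : Summable (fun k => ‖a k‖ * (2 * Real.pi * wt k)) := by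
    refine ((ha 1).mul_left (2 * Real.pi)).congr fun k => ?_
    ring
  have hbd : ∀ k x, ‖a k • (ee k x • lf k)‖ ≤ ‖a k‖ * (2 * Real.pi * wt k) := by
    intro k x
    rw [norm_smul, norm_smul, norm_ee, one_mul]
    gcongr
    refine ContinuousLinearMap.opNorm_le_bound _ ?_ (lf_norm k)
    have := one_le_wt k
    positivity
  have h := hasFDerivAt_tsum (𝕜 := ℝ) (f := fun k x => a k * ee k x)
    (f' := fun k x => a k • (ee k x • lf k)) (u := fun k => ‖a k‖ * (2 * Real.pi * wt k))
    (x₀ := x) hb (fun k x => (ee_hasFDerivAt k x).const_mul (a k)) hbd (ha.summable x) x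
  refine ⟨h.differentiableAt, fun y => ?_⟩
  have h' : HasFDerivAt (FS a) (∑' k, a k • (ee k x • lf k)) x := h
  rw [h'.fderiv]
  have hs : Summable (fun k => a k • (ee k x • lf k)) :=
    Summable.of_norm_bounded hb (fun k => hbd k x)
  have := (ContinuousLinearMap.apply ℝ ℂ y).map_tsum hs
  simp only [ContinuousLinearMap.apply_apply] at this
  rw [this, FS]
  refine tsum_congr fun k => ?_
  simp; ring

lemma RD.lf {d : ℕ} {a : (Fin d → ℤ) → ℂ} (ha : RD a) (y : Fin d → ℝ) :
    RD (fun k => lf k y * a k) :=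
  ha.mul (2 * Real.pi * ‖y‖) 1 (fun k => (lf_norm k y).trans (le_of_eq (by ring)))

lemma FS_contDiff_nat {d : ℕ} (n : ℕ) : ∀ {a : (Fin d → ℤ) → ℂ}, RD a → ContDiff ℝ n (FS a) := by
  induction n with
  | zero =>
    intro a ha
    have : Differentiable ℝ (FS a) := fun x => (FS_hasFDerivAt ha x).1
    simpa using this.continuous
  | succ n ih =>
    intro a ha
    push_cast
    rw [contDiff_succ_iff_fderiv_apply]
    refine ⟨fun x => (FS_hasFDerivAt ha x).1, by simp, fun y => ?_⟩
    have : (fun x => fderiv ℝ (FS a) x y) = FS (fun k => lf k y * a k) := by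
      ext x; exact (FS_hasFDerivAt ha x).2 y
    rw [this]
    exact ih (ha.lf y)

lemma FS_contDiff {d : ℕ} {a : (Fin d → ℤ) → ℂ} (ha : RD a) : ContDiff ℝ (⊤ : ℕ∞) (FS a) :=
  contDiff_infty.2 fun n => FS_contDiff_nat n ha

lemma ee_periodic {d : ℕ} (k : Fin d → ℤ) : ZPeriodic (ee k) := by
  intro x m
  rw [ee, ee, Complex.exp_eq_exp_iff_exists_int]
  refine ⟨∑ j, k j * m j, ?_⟩
  push_cast
  simp only [mul_add, Finset.sum_add_distrib]
  ring

lemma FS_periodic {d : ℕ} (a : (Fin d → ℤ) → ℂ) : ZPeriodic (FS a) := by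
  intro x m
  unfold FS
  refine tsum_congr fun k => ?_
  rw [ee_periodic k x m]

lemma isCompact_cube (d : ℕ) : IsCompact (cube d) := isCompact_Icc

lemma integral_pd_zero {d : ℕ} {E : Type*} [NormedAddCommGroup E] [NormedSpace ℝ E]
    [CompleteSpace E] {G : (Fin d → ℝ) → E} (hG : ContDiff ℝ 1 G)
    (hp : ZPeriodic G) (j : Fin d) : ∫ x in cube d, fderiv ℝ G x (Pi.single j 1) = 0 := by
  cases d with
  | zero => exact j.elim0
  | succ n =>
    have hc : Continuous (fun x => fderiv ℝ G x (Pi.single j 1)) :=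
      (hG.continuous_fderiv (by norm_num)).clm_apply continuous_const
    have hsum : ∀ x : Fin (n+1) → ℝ,
        ∑ i, (if i = j then fderiv ℝ G x else 0) (Pi.single i (1:ℝ) : Fin (n+1) → ℝ)
        = fderiv ℝ G x (Pi.single j 1) := by
      intro x
      rw [Finset.sum_eq_single j]
      · simp
      · intro b _ hb; simp [hb]
      · simp
    have h := integral_divergence_of_hasFDerivAt_off_countable' (E := E) (n := n) 0 1 zero_le_one
      (fun i x => if i = j then G x else 0) (fun i x => if i = j then fderiv ℝ G x else 0) ∅
      Set.countable_empty
      (fun i => by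
        by_cases hi : i = j
        · simpa [hi] using hG.continuous.continuousOn
        · simpa [hi] using continuousOn_const)
      (fun x _ i => by
        by_cases hi : i = j
        · simpa [hi] using (hG.differentiable (by norm_num) x).hasFDerivAt
        · simpa [hi] using hasFDerivAt_const (0 : E) x)
      (by
        simp_rw [hsum]
        exact hc.continuousOn.integrableOn_compact isCompact_Icc)
    simp_rw [hsum] at h
    rw [cube, h]
    refine Finset.sum_eq_zero fun i _ => ?_
    by_cases hi : i = j
    · subst hi
      simp only [if_true]
      rw [sub_eq_zero]
      congr 1
      ext x
      have := hp (Fin.insertNth i (0:ℝ) x) (Pi.single i 1)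
      simp only [Pi.zero_apply, Pi.one_apply]
      rw [← this]
      congr 1
      ext l
      rcases Fin.eq_self_or_eq_succAbove i l with rfl | ⟨l, rfl⟩
      · simp
      · simp [Pi.single_apply, Fin.succAbove_ne]
    · simp [hi]

/-- Fourier coefficient -/
def cf {d : ℕ} (g : (Fin d → ℝ) → ℂ) (k : Fin d → ℤ) : ℂ := ∫ x in cube d, ee k (-x) * g x

/-- complex partial derivative -/
def pdC {d : ℕ} (j : Fin d) (g : (Fin d → ℝ) → ℂ) (x : Fin d → ℝ) : ℂ :=
  fderiv ℝ g x (Pi.single j 1)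

/-- symbol of the partial derivative -/
def Ds {d : ℕ} (k : Fin d → ℤ) (j : Fin d) : ℂ := 2 * Real.pi * Complex.I * (k j : ℂ)

lemma lf_single {d : ℕ} (k : Fin d → ℤ) (j : Fin d) : lf k (Pi.single j 1) = Ds k j := by
  rw [lf_apply, Ds]
  simp [Pi.single_apply]

lemma ee_neg {d : ℕ} (k : Fin d → ℤ) (x : Fin d → ℝ) : ee k (-x) = ee (-k) x := by
  rw [ee, ee]; simp

lemma Ds_neg {d : ℕ} (k : Fin d → ℤ) (j : Fin d) : Ds (-k) j = - Ds k j := by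
  simp [Ds]

lemma pdC_smooth {d : ℕ} (j : Fin d) {g : (Fin d → ℝ) → ℂ} (hg : ContDiff ℝ (⊤ : ℕ∞) g) :
    ContDiff ℝ (⊤ : ℕ∞) (pdC j g) :=
  (hg.fderiv_right (m := ((⊤ : ℕ∞) : WithTop ℕ∞)) (by simp)).clm_apply contDiff_const

lemma fderiv_periodic {d : ℕ} {E : Type*} [NormedAddCommGroup E] [NormedSpace ℝ E]
    {g : (Fin d → ℝ) → E} (hp : ZPeriodic g) : ZPeriodic (fderiv ℝ g) := by
  intro x k
  have h := fderiv_comp_add_right (𝕜 := ℝ) (f := g) (x := x) (fun i => (k i : ℝ))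
  have e : (fun y => g (y + fun i => (k i : ℝ))) = g := by
    ext y; exact hp y k
  rw [e] at h
  exact h.symm

lemma pdC_periodic {d : ℕ} (j : Fin d) {g : (Fin d → ℝ) → ℂ} (hp : ZPeriodic g) :
    ZPeriodic (pdC j g) := by
  intro x k
  unfold pdC
  rw [fderiv_periodic hp x k]

lemma cf_pdC {d : ℕ} (j : Fin d) {g : (Fin d → ℝ) → ℂ} (hg : ContDiff ℝ (⊤ : ℕ∞) g)
    (hp : ZPeriodic g) (k : Fin d → ℤ) : cf (pdC j g) k = Ds k j * cf g k := by
  have hee : ContDiff ℝ (⊤ : ℕ∞) (ee (-k)) := by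
    have e : (fun y => Complex.exp (lf (-k) y)) = ee (-k) := by
      ext y; rw [lf_apply, ee]
    rw [← e]
    exact (lf (-k)).contDiff.cexp
  have hg1 : ContDiff ℝ 1 (fun x => ee (-k) x * g x) := (hee.mul hg).of_le (by exact_mod_cast le_top)
  have hper : ZPeriodic (fun x => ee (-k) x * g x) := by
    intro x m
    simp only
    rw [ee_periodic (-k) x m, hp x m]
  have h := integral_pd_zero hg1 hper j
  have hd : ∀ x, fderiv ℝ (fun x => ee (-k) x * g x) x (Pi.single j 1)
      = ee (-k) x * pdC j g x - Ds k j * (ee (-k) x * g x) := by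
    intro x
    have h1 := (ee_hasFDerivAt (-k) x).mul (hg.differentiable (by simp) x).hasFDerivAt
    have h2 : fderiv ℝ (fun x => ee (-k) x * g x) x = _ := h1.fderiv
    rw [h2]
    simp [lf_single, Ds_neg, pdC]
    ring
  simp_rw [hd] at h
  have hi1 : IntegrableOn (fun x => ee (-k) x * pdC j g x) (cube d) :=
    ((hee.continuous.mul (pdC_smooth j hg).continuous).continuousOn).integrableOn_compact
      (isCompact_cube d)
  have hi2 : IntegrableOn (fun x => Ds k j * (ee (-k) x * g x)) (cube d) :=
    ((continuous_const.mul hg1.continuous).continuousOn).integrableOn_compact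
      (isCompact_cube d)
  rw [integral_sub hi1 hi2, integral_const_mul, sub_eq_zero] at h
  simpa [cf, ee_neg] using h

lemma vol_cube (d : ℕ) : volume.real (cube d) = 1 := by
  simp [cube, Measure.real, Real.volume_Icc_pi]

lemma cf_decay {d : ℕ} (N : ℕ) : ∀ {g : (Fin d → ℝ) → ℂ}, ContDiff ℝ (⊤ : ℕ∞) g → ZPeriodic g →
    ∃ C : ℝ, ∀ k, ‖cf g k‖ * wt k ^ N ≤ C := by
  induction N with
  | zero =>
    intro g hg hp
    obtain ⟨C, hC⟩ := (isCompact_cube d).exists_bound_of_continuousOn hg.continuous.continuousOn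
    refine ⟨C, fun k => ?_⟩
    have := norm_setIntegral_le_of_norm_le_const (μ := volume) (s := cube d) (C := C)
      (f := fun x => ee k (-x) * g x) (isCompact_cube d).measure_lt_top
      (fun x hx => by rw [norm_mul, norm_ee, one_mul]; exact hC x hx)
    simpa [vol_cube, cf] using this
  | succ N ih =>
    intro g hg hp
    obtain ⟨C0, hC0⟩ := ih hg hp
    have : ∀ j, ∃ C : ℝ, ∀ k, ‖cf (pdC j g) k‖ * wt k ^ N ≤ C :=
      fun j => ih (pdC_smooth j hg) (pdC_periodic j hp)
    choose C hC using this
    refine ⟨C0 + ∑ j, C j, fun k => ?_⟩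
    have h1 := one_le_wt k
    have hj : ∀ j, |(k j : ℝ)| * ‖cf g k‖ ≤ ‖cf (pdC j g) k‖ := by
      intro j
      rw [cf_pdC j hg hp, norm_mul]
      gcongr
      have : ‖Ds k j‖ = 2 * Real.pi * |(k j : ℝ)| := by
        simp [Ds, abs_of_pos Real.pi_pos]
      rw [this]
      have h3 : 1 ≤ 2 * Real.pi := by linarith [Real.pi_gt_three]
      exact le_mul_of_one_le_left (abs_nonneg _) h3
    calc ‖cf g k‖ * wt k ^ (N+1)
        = ‖cf g k‖ * wt k ^ N + ∑ j, (|(k j : ℝ)| * ‖cf g k‖) * wt k ^ N := by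
          rw [← Finset.sum_mul, ← Finset.sum_mul, pow_succ]
          conv_lhs => rw [show wt k = 1 + ∑ j, |(k j : ℝ)| from rfl]
          conv_rhs => rw [show wt k = 1 + ∑ j, |(k j : ℝ)| from rfl]
          ring
      _ ≤ C0 + ∑ j, C j := by
          refine add_le_add (hC0 k) (Finset.sum_le_sum fun j _ => ?_)
          refine le_trans ?_ (hC j k)
          gcongr
          exact hj j

lemma cf_RD {d : ℕ} {g : (Fin d → ℝ) → ℂ} (hg : ContDiff ℝ (⊤ : ℕ∞) g) (hp : ZPeriodic g) :
    RD (cf g) := RD.of_bound fun N => cf_decay N hg hp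

lemma mF_toT {d : ℕ} (n : Fin d → ℤ) (x : Fin d → ℝ) :
    UnitAddTorus.mFourier n (toT x) = ee n x := by
  have : UnitAddTorus.mFourier n (toT x) = ∏ i, fourier (n i) (x i : UnitAddCircle) := rfl
  rw [this, ee]
  simp_rw [fourier_coe_apply]
  rw [← Complex.exp_sum]
  congr 1
  push_cast
  rw [Finset.mul_sum]
  refine Finset.sum_congr rfl fun i _ => by ring

lemma FS_cf {d : ℕ} {g : (Fin d → ℝ) → ℂ} (hg : ContDiff ℝ (⊤ : ℕ∞) g) (hp : ZPeriodic g)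
    (x : Fin d → ℝ) : FS (cf g) x = g x := by
  obtain ⟨F, hF, hFg⟩ := exists_lift hg.continuous hp
  have hco : ∀ n, UnitAddTorus.mFourierCoeff F n = cf g n := by
    intro n
    rw [UnitAddTorus.mFourierCoeff_eq_integral F n 0, cf]
    have e : ∀ x : Fin d → ℝ, UnitAddTorus.mFourier (-n) (fun i => (x i : UnitAddCircle)) •
        F (fun i => (x i : UnitAddCircle)) = ee n (-x) * g x := by
      intro x
      rw [ee_neg, ← hFg, ← mF_toT]; rfl
    simp_rw [e]
    refine setIntegral_congr_set ?_
    have := Measure.univ_pi_Ioc_ae_eq_Icc (μ := fun _ : Fin d => (volume : Measure ℝ))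
      (f := 0) (g := 1)
    have e2 : {x : Fin d → ℝ | ∀ i, x i ∈ Set.Ioc ((0 : Fin d → ℝ) i) ((0 : Fin d → ℝ) i + 1)}
       = Set.univ.pi fun i => Set.Ioc ((0 : Fin d → ℝ) i) ((1 : Fin d → ℝ) i) := by
      ext; simp
    rw [e2]
    exact this
  have hs : Summable (UnitAddTorus.mFourierCoeff F) := by
    have : UnitAddTorus.mFourierCoeff F = cf g := funext hco
    rw [this]
    exact (cf_RD hg hp).summable_norm.of_norm
  have h := UnitAddTorus.hasSum_mFourier_series_apply_of_summable (f := ⟨F, hF⟩) hs (toT x)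
  have h2 := h.tsum_eq
  rw [ContinuousMap.coe_mk, hFg] at h2
  rw [← h2, FS]
  refine tsum_congr fun k => ?_
  rw [mF_toT, smul_eq_mul]
  congr 1
  exact (hco k).symm

/-- symbol of the derivative on frequency space -/
def Dx {d : ℕ} (ξ : EuclideanSpace ℝ (Fin d)) (j : Fin d) : ℂ :=
  2 * Real.pi * Complex.I * ((ξ j : ℝ) : ℂ)

/-- symbol of the Laplacian -/
def qx {d : ℕ} (ξ : EuclideanSpace ℝ (Fin d)) : ℂ := ∑ j, Dx ξ j * Dx ξ j

/-- Kronecker delta -/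
def kd {d : ℕ} (i j : Fin d) : ℂ := if i = j then 1 else 0

/-- the symbol of the anti-divergence -/
def mm {d : ℕ} (i j l : Fin d) (ξ : EuclideanSpace ℝ (Fin d)) : ℂ :=
  (Dx ξ j * kd i l + Dx ξ i * kd j l) * (qx ξ)⁻¹
    + (-1 / ((d : ℂ) - 1)) * kd i j * Dx ξ l * (qx ξ)⁻¹
    + (-((d : ℂ) - 2) / ((d : ℂ) - 1)) * (Dx ξ i * Dx ξ j * Dx ξ l) * ((qx ξ)⁻¹ * (qx ξ)⁻¹)

lemma Dx_iv {d : ℕ} (k : Fin d → ℤ) (j : Fin d) : Dx (iv k) j = Ds k j := by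
  simp [Dx, Ds, iv]

lemma qx_ne {d : ℕ} {ξ : EuclideanSpace ℝ (Fin d)} (h : ξ ≠ 0) : qx ξ ≠ 0 := by
  have e : qx ξ = ((-(4 * Real.pi^2) * ∑ j, ξ j ^ 2 : ℝ) : ℂ) := by
    unfold qx Dx
    push_cast
    rw [Finset.mul_sum]
    refine Finset.sum_congr rfl fun j _ => ?_
    linear_combination 4 * (Real.pi : ℂ)^2 * (ξ j : ℂ)^2 * Complex.I_mul_I
  rw [e]
  have h2 : ∑ j, ξ j ^ 2 ≠ 0 := by
    rw [← EuclideanSpace.real_norm_sq_eq]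
    simpa using h
  have hp := Real.pi_pos
  have : (-(4 * Real.pi^2) * ∑ j, ξ j ^ 2 : ℝ) ≠ 0 := mul_ne_zero (by
    have : 0 < 4 * Real.pi^2 := by positivity
    linarith) h2
  exact_mod_cast this

lemma Dx_smooth {d : ℕ} (j : Fin d) :
    ContDiff ℝ ((⊤ : ℕ∞) : WithTop ℕ∞) (fun ξ : EuclideanSpace ℝ (Fin d) => Dx ξ j) := by
  unfold Dx
  have h : ContDiff ℝ ((⊤ : ℕ∞) : WithTop ℕ∞) (fun ξ : EuclideanSpace ℝ (Fin d) => ((ξ j : ℝ) : ℂ)) :=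
    Complex.ofRealCLM.contDiff.comp (EuclideanSpace.proj (𝕜 := ℝ) j).contDiff
  exact contDiff_const.mul h

lemma mm_smooth {d : ℕ} (i j l : Fin d) (ξ : EuclideanSpace ℝ (Fin d)) (h : ξ ≠ 0) :
    ContDiffAt ℝ ((⊤ : ℕ∞) : WithTop ℕ∞) (mm i j l) ξ := by
  have hD := fun j => (Dx_smooth (d := d) j).contDiffAt (x := ξ)
  have hq : ContDiffAt ℝ ((⊤ : ℕ∞) : WithTop ℕ∞) (qx (d := d)) ξ := by
    unfold qx
    exact ContDiffAt.sum fun j _ => (hD j).mul (hD j)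
  have hqi : ContDiffAt ℝ ((⊤ : ℕ∞) : WithTop ℕ∞) (fun ξ => (qx (d := d) ξ)⁻¹) ξ := hq.inv (qx_ne h)
  have hi := hD i
  have hj := hD j
  have hl := hD l
  unfold mm
  exact ((((hj.mul contDiffAt_const).add (hi.mul contDiffAt_const)).mul hqi).add
    ((contDiffAt_const.mul hl).mul hqi)).add
    ((contDiffAt_const.mul ((hi.mul hj).mul hl)).mul (hqi.mul hqi))

lemma mm_zero {d : ℕ} (i j l : Fin d) : mm i j l 0 = 0 := by
  simp [mm, Dx]

lemma mm_hom {d : ℕ} (i j l : Fin d) (t : ℝ) (ht : 0 < t) (ξ : EuclideanSpace ℝ (Fin d)) :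
    mm i j l (t • ξ) = (t : ℂ)⁻¹ * mm i j l ξ := by
  have ht' : (t : ℂ) ≠ 0 := by exact_mod_cast ht.ne'
  have hD : ∀ j, Dx (t • ξ) j = t * Dx ξ j := by
    intro j; simp [Dx]; ring
  have hq : (qx (t • ξ))⁻¹ = (t : ℂ)⁻¹ * (t : ℂ)⁻¹ * (qx ξ)⁻¹ := by
    rw [← mul_inv, ← mul_inv]
    congr 1
    unfold qx
    rw [Finset.mul_sum]
    refine Finset.sum_congr rfl fun j _ => ?_
    rw [hD]; ring
  unfold mm
  rw [hq]
  simp only [hD]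
  generalize (qx ξ)⁻¹ = Q
  generalize -1 / ((d : ℂ) - 1) = A
  generalize -((d : ℂ) - 2) / ((d : ℂ) - 1) = B
  field_simp

lemma mm_symm {d : ℕ} (i j l : Fin d) (ξ : EuclideanSpace ℝ (Fin d)) :
    mm i j l ξ = mm j i l ξ := by
  have : kd i j = kd j i := by simp [kd, eq_comm]
  unfold mm
  rw [this]; ring

lemma sum_kd {d : ℕ} (i : Fin d) (f : Fin d → ℂ) : ∑ j, f j * kd i j = f i := by
  simp [kd]

lemma mm_trace {d : ℕ} (hd : 2 ≤ d) (l : Fin d) (ξ : EuclideanSpace ℝ (Fin d)) :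
    ∑ i, mm i i l ξ = 0 := by
  have hd1 : ((d : ℂ) - 1) ≠ 0 := by
    rw [sub_ne_zero]; exact_mod_cast (by omega : d ≠ 1)
  by_cases h : ξ = 0
  · subst h; simp [mm_zero]
  have hq := qx_ne h
  have e : ∀ i, mm i i l ξ = (Dx ξ i * kd l i) * (2 * (qx ξ)⁻¹)
    + (-1 / ((d : ℂ) - 1)) * Dx ξ l * (qx ξ)⁻¹
    + (Dx ξ i * Dx ξ i) * ((-((d : ℂ) - 2) / ((d : ℂ) - 1)) * Dx ξ l * ((qx ξ)⁻¹ * (qx ξ)⁻¹)) := by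
    intro i
    have : kd i l = kd l i := by simp [kd, eq_comm]
    have h2 : kd i i = 1 := by simp [kd]
    unfold mm
    rw [this, h2]; ring
  simp_rw [e]
  rw [Finset.sum_add_distrib, Finset.sum_add_distrib, ← Finset.sum_mul, Finset.sum_const,
    ← Finset.sum_mul, sum_kd, show ∑ i, Dx ξ i * Dx ξ i = qx ξ from rfl]
  simp
  field_simp
  ring

lemma mm_div {d : ℕ} (hd : 2 ≤ d) (i l : Fin d) (ξ : EuclideanSpace ℝ (Fin d)) (h : ξ ≠ 0) :
    ∑ j, Dx ξ j * mm i j l ξ = kd i l := by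
  have hd1 : ((d : ℂ) - 1) ≠ 0 := by
    rw [sub_ne_zero]; exact_mod_cast (by omega : d ≠ 1)
  have hq := qx_ne h
  have e : ∀ j, Dx ξ j * mm i j l ξ =
      (Dx ξ j * Dx ξ j) * (kd i l * (qx ξ)⁻¹)
      + (Dx ξ j * kd l j) * (Dx ξ i * (qx ξ)⁻¹)
      + (Dx ξ j * kd i j) * ((-1 / ((d : ℂ) - 1)) * Dx ξ l * (qx ξ)⁻¹)
      + (Dx ξ j * Dx ξ j) * ((-((d : ℂ) - 2) / ((d : ℂ) - 1)) * (Dx ξ i * Dx ξ l) *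
        ((qx ξ)⁻¹ * (qx ξ)⁻¹)) := by
    intro j
    have : kd j l = kd l j := by simp [kd, eq_comm]
    unfold mm
    rw [this]; ring
  simp_rw [e]
  rw [Finset.sum_add_distrib, Finset.sum_add_distrib, Finset.sum_add_distrib,
    ← Finset.sum_mul, ← Finset.sum_mul, ← Finset.sum_mul, ← Finset.sum_mul, sum_kd, sum_kd,
    show ∑ i, Dx ξ i * Dx ξ i = qx ξ from rfl]
  field_simp
  ring

lemma mm_lap {d : ℕ} (i j : Fin d) (ξ : EuclideanSpace ℝ (Fin d)) (c : Fin d → ℂ)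
    (hc : ∑ l, Dx ξ l * c l = 0) :
    ∑ l, mm i j l ξ * (qx ξ * c l) = Dx ξ j * c i + Dx ξ i * c j := by
  by_cases h : ξ = 0
  · subst h; simp [mm_zero, Dx]
  have hq := qx_ne h
  have e : ∀ l, mm i j l ξ * (qx ξ * c l) = (c l * kd i l) * Dx ξ j + (c l * kd j l) * Dx ξ i
    + (Dx ξ l * c l) * ((-1 / ((d : ℂ) - 1)) * kd i j +
      (-((d : ℂ) - 2) / ((d : ℂ) - 1)) * (Dx ξ i * Dx ξ j) * (qx ξ)⁻¹) := by
    intro l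
    unfold mm
    generalize -1 / ((d : ℂ) - 1) = A
    generalize -((d : ℂ) - 2) / ((d : ℂ) - 1) = B
    field_simp
    ring
  simp_rw [e]
  rw [Finset.sum_add_distrib, Finset.sum_add_distrib,
    ← Finset.sum_mul, ← Finset.sum_mul, ← Finset.sum_mul, sum_kd, sum_kd, hc]
  ring

/-- the kernel operator -/
def Op {d : ℕ} (W : KerIdx d → ℂ) (Y : KerIdx d → Fin d → ℝ) (g : (Fin d → ℝ) → ℂ)
    (x : Fin d → ℝ) : ℂ := ∫ ω, W ω * g (x - Y ω) ∂(kerMu d)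

lemma Op_tsum {d : ℕ} {W : KerIdx d → ℂ} {Y : KerIdx d → Fin d → ℝ}
    (hW : Integrable W (kerMu d)) (hY : Measurable Y) {ι : Type*} [Countable ι] (a : ι → ℂ)
    (ha : Summable fun i => ‖a i‖) (κ : ι → Fin d → ℤ) (x : Fin d → ℝ) :
    Op W Y (fun y => ∑' i, a i * ee (κ i) y) x =
      ∑' i, (∫ ω, W ω * ee (κ i) (-(Y ω)) ∂(kerMu d)) * a i * ee (κ i) x := by
  have hIntg : ∀ i, Integrable (fun ω => W ω * (a i * ee (κ i) (x - Y ω))) (kerMu d) := by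
    intro i
    refine hW.mul_bdd (c := ‖a i‖) ?_ ?_
    · refine Measurable.aestronglyMeasurable ?_
      exact measurable_const.mul ((continuous_ee (κ i)).measurable.comp (measurable_const.sub hY))
    · filter_upwards with ω
      rw [norm_mul, norm_ee, mul_one]
  have h := hasSum_integral_of_summable_integral_norm hIntg (by
    simp_rw [norm_mul, norm_ee, mul_one, integral_mul_const]
    exact ha.mul_left _)
  have h2 := h.tsum_eq
  unfold Op
  simp_rw [← tsum_mul_left]
  rw [← h2]
  refine tsum_congr fun i => ?_
  rw [mul_assoc, ← integral_mul_const]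
  congr 1
  ext ω
  rw [ee_sub]
  ring

lemma bdd_of_periodic {d : ℕ} {E : Type*} [NormedAddCommGroup E] {g : (Fin d → ℝ) → E}
    (hg : Continuous g) (hp : ZPeriodic g) : ∃ C, ∀ x, ‖g x‖ ≤ C := by
  obtain ⟨F, hF, h⟩ := exists_lift hg hp
  obtain ⟨C, hC⟩ := isCompact_univ.exists_bound_of_continuousOn hF.continuousOn
  exact ⟨C, fun x => by rw [← h]; exact hC _ trivial⟩

lemma Op_integrable {d : ℕ} {W : KerIdx d → ℂ} {Y : KerIdx d → Fin d → ℝ}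
    (hW : Integrable W (kerMu d)) (hY : Measurable Y) {g : (Fin d → ℝ) → ℂ}
    (hg : Continuous g) (hp : ZPeriodic g) (x : Fin d → ℝ) :
    Integrable (fun ω => W ω * g (x - Y ω)) (kerMu d) := by
  obtain ⟨C, hC⟩ := bdd_of_periodic hg hp
  refine hW.mul_bdd (c := C) ?_ ?_
  · exact (hg.measurable.comp (measurable_const.sub hY)).aestronglyMeasurable
  · filter_upwards with ω using hC _

lemma exists_kers (d : ℕ) : ∃ (W : Fin d → Fin d → Fin d → KerIdx d → ℂ)
    (Y : Fin d → Fin d → Fin d → KerIdx d → Fin d → ℝ),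
    (∀ i j l, Integrable (W i j l) (kerMu d)) ∧ (∀ i j l, Measurable (Y i j l)) ∧
    ∀ i j l, ∀ k : Fin d → ℤ,
      ∫ ω, W i j l ω * ee k (-(Y i j l ω)) ∂(kerMu d) = mm i j l (iv k) := by
  have := fun i j l : Fin d => exists_ker (mm i j l) (mm_smooth i j l) (mm_zero i j l) (mm_hom i j l)
  choose W Y h1 h2 h3 using this
  exact ⟨W, Y, h1, h2, h3⟩

/-- The family of kernels realising the symbols `mm i j l`. -/
structure Kers (d : ℕ) where
  W : Fin d → Fin d → Fin d → KerIdx d → ℂ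
  Y : Fin d → Fin d → Fin d → KerIdx d → Fin d → ℝ
  hW : ∀ i j l, Integrable (W i j l) (kerMu d)
  hY : ∀ i j l, Measurable (Y i j l)
  hm : ∀ i j l, ∀ k : Fin d → ℤ,
      ∫ ω, W i j l ω * ee k (-(Y i j l ω)) ∂(kerMu d) = mm i j l (iv k)

/-- complexified component -/
def Vc {d : ℕ} (v : (Fin d → ℝ) → Fin d → ℝ) (l : Fin d) (x : Fin d → ℝ) : ℂ := ((v x l : ℝ) : ℂ)

/-- The operator. -/
def R0 {d : ℕ} (K : Kers d) (v : (Fin d → ℝ) → Fin d → ℝ) (x : Fin d → ℝ) (i j : Fin d) : ℝ :=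
  (∑ l, Op (K.W i j l) (K.Y i j l) (Vc v l) x).re

/-- Its Fourier coefficients -/
def Ac {d : ℕ} (v : (Fin d → ℝ) → Fin d → ℝ) (i j : Fin d) (k : Fin d → ℤ) : ℂ :=
  ∑ l, mm i j l (iv k) * cf (Vc v l) k

section basic
variable {d : ℕ} {v : (Fin d → ℝ) → Fin d → ℝ}

lemma comp_smooth (hv : ContDiff ℝ (⊤ : ℕ∞) v) (l : Fin d) :
    ContDiff ℝ (⊤ : ℕ∞) (fun x => v x l) := contDiff_pi.1 hv l

lemma Vc_smooth (hv : ContDiff ℝ (⊤ : ℕ∞) v) (l : Fin d) : ContDiff ℝ (⊤ : ℕ∞) (Vc v l) :=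
  Complex.ofRealCLM.contDiff.comp (comp_smooth hv l)

lemma Vc_periodic (hv : ZPeriodic v) (l : Fin d) : ZPeriodic (Vc v l) := by
  intro x k
  unfold Vc
  rw [hv x k]

lemma mm_bdd (K : Kers d) (i j l : Fin d) (k : Fin d → ℤ) :
    ‖mm i j l (iv k)‖ ≤ (∫ ω, ‖K.W i j l ω‖ ∂(kerMu d)) * wt k ^ 0 := by
  rw [← K.hm, pow_zero, mul_one]
  refine (norm_integral_le_integral_norm _).trans (le_of_eq ?_)
  simp_rw [norm_mul, norm_ee, mul_one]

lemma mmcf_RD (K : Kers d) (hv : ContDiff ℝ (⊤ : ℕ∞) v) (hp : ZPeriodic v) (i j l : Fin d) :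
    RD (fun k => mm i j l (iv k) * cf (Vc v l) k) :=
  (cf_RD (Vc_smooth hv l) (Vc_periodic hp l)).mul _ 0 (mm_bdd K i j l)

lemma Ac_RD (K : Kers d) (hv : ContDiff ℝ (⊤ : ℕ∞) v) (hp : ZPeriodic v) (i j : Fin d) :
    RD (Ac v i j) := RD.sum Finset.univ (fun l => mmcf_RD K hv hp i j l)

lemma Op_FS (K : Kers d) (hv : ContDiff ℝ (⊤ : ℕ∞) v) (hp : ZPeriodic v) (i j l : Fin d)
    (x : Fin d → ℝ) : Op (K.W i j l) (K.Y i j l) (Vc v l) x =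
      FS (fun k => mm i j l (iv k) * cf (Vc v l) k) x := by
  have e : Vc v l = fun y => ∑' k, cf (Vc v l) k * ee k y := by
    ext y; exact (FS_cf (Vc_smooth hv l) (Vc_periodic hp l) y).symm
  conv_lhs => rw [e]
  rw [Op_tsum (K.hW i j l) (K.hY i j l) _
    (cf_RD (Vc_smooth hv l) (Vc_periodic hp l)).summable_norm]
  simp_rw [K.hm]
  rfl

lemma R0_FS (K : Kers d) (hv : ContDiff ℝ (⊤ : ℕ∞) v) (hp : ZPeriodic v) (i j : Fin d)
    (x : Fin d → ℝ) : R0 K v x i j = (FS (Ac v i j) x).re := by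
  unfold R0 Ac
  rw [FS_sum _ (fun l => mmcf_RD K hv hp i j l)]
  simp_rw [Op_FS K hv hp]

lemma pd_reFS {a : (Fin d → ℤ) → ℂ} (ha : RD a) (j : Fin d) (x : Fin d → ℝ) :
    pd j (fun y => (FS a y).re) x = (FS (fun k => Ds k j * a k) x).re := by
  obtain ⟨h1, h2⟩ := FS_hasFDerivAt ha x
  have h := Complex.reCLM.hasFDerivAt.comp x h1.hasFDerivAt
  have h3 : fderiv ℝ (fun y => (FS a y).re) x = _ := h.fderiv
  unfold pd
  rw [h3]
  simp [h2, lf_single]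

lemma pdC_ofReal {u : (Fin d → ℝ) → ℝ} (hu : Differentiable ℝ u) (j : Fin d) (x : Fin d → ℝ) :
    pdC j (fun y => (u y : ℂ)) x = (pd j u x : ℂ) := by
  have h := Complex.ofRealCLM.hasFDerivAt.comp x (hu x).hasFDerivAt
  have h3 : fderiv ℝ (fun y => (u y : ℂ)) x = _ := h.fderiv
  unfold pdC pd
  rw [h3]
  simp

lemma pd_smooth {u : (Fin d → ℝ) → ℝ} (hu : ContDiff ℝ (⊤ : ℕ∞) u) (j : Fin d) :
    ContDiff ℝ (⊤ : ℕ∞) (pd j u) :=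
  (hu.fderiv_right (m := ((⊤ : ℕ∞) : WithTop ℕ∞)) (by simp)).clm_apply contDiff_const

lemma pd_periodic {u : (Fin d → ℝ) → ℝ} (hu : ZPeriodic u) (j : Fin d) : ZPeriodic (pd j u) := by
  intro x k
  unfold pd
  rw [fderiv_periodic hu x k]

lemma cf_sum {ι : Type*} (s : Finset ι) {g : ι → (Fin d → ℝ) → ℂ} (hg : ∀ i, Continuous (g i))
    (k : Fin d → ℤ) : cf (fun x => ∑ i ∈ s, g i x) k = ∑ i ∈ s, cf (g i) k := by
  unfold cf
  simp_rw [Finset.mul_sum]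
  refine integral_finset_sum _ fun i _ => ?_
  exact ((((continuous_ee k).comp continuous_neg).mul (hg i)).continuousOn).integrableOn_compact
    (isCompact_cube d)

lemma lap_SMZ (hv : SmoothMeanZeroField d v) : SmoothMeanZeroField d (lap v) := by
  obtain ⟨hs, hp, -⟩ := hv
  have hpc : ∀ i, ZPeriodic (fun z => v z i) := fun i x k => by simp only [hp x k]
  have hs1 : ∀ i j, ContDiff ℝ (⊤ : ℕ∞) (pd j (fun z => v z i)) :=
    fun i j => pd_smooth (comp_smooth hs i) j
  refine ⟨?_, ?_, ?_⟩
  · refine contDiff_pi.2 fun i => ?_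
    unfold lap
    exact ContDiff.sum fun j _ => pd_smooth (hs1 i j) j
  · intro x k
    ext i
    unfold lap
    refine Finset.sum_congr rfl fun j _ => ?_
    exact pd_periodic (pd_periodic (hpc i) j) j x k
  · intro i
    unfold lap
    rw [integral_finset_sum]
    · refine Finset.sum_eq_zero fun j _ => ?_
      exact integral_pd_zero ((hs1 i j).of_le (by exact_mod_cast le_top)) (pd_periodic (hpc i) j) j
    · intro j _
      exact (pd_smooth (hs1 i j) j).continuous.continuousOn.integrableOn_compact (isCompact_cube d)

lemma cf_lap (hs : ContDiff ℝ (⊤ : ℕ∞) v) (hp : ZPeriodic v) (l : Fin d) (k : Fin d → ℤ) :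
    cf (Vc (lap v) l) k = qx (iv k) * cf (Vc v l) k := by
  have hV := Vc_smooth hs l
  have hVp := Vc_periodic hp l
  have e : Vc (lap v) l = fun x => ∑ j, pdC j (pdC j (Vc v l)) x := by
    ext x
    unfold Vc lap
    push_cast
    refine Finset.sum_congr rfl fun j _ => ?_
    have h1 : pdC j (fun x => ((v x l : ℝ) : ℂ)) = fun x => ((pd j (fun z => v z l) x : ℝ) : ℂ) := by
      ext y
      exact pdC_ofReal ((comp_smooth hs l).differentiable (by simp)) j y
    rw [h1, pdC_ofReal ((pd_smooth (comp_smooth hs l) j).differentiable (by simp)) j x]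
  rw [e, cf_sum _ (fun j => (pdC_smooth j (pdC_smooth j hV)).continuous), qx, Finset.sum_mul]
  refine Finset.sum_congr rfl fun j _ => ?_
  rw [cf_pdC j (pdC_smooth j hV) (pdC_periodic j hVp), cf_pdC j hV hVp, Dx_iv]
  ring

lemma cf_div (hs : ContDiff ℝ (⊤ : ℕ∞) v) (hp : ZPeriodic v)
    (hdiv : ∀ x, ∑ i, pd i (fun y => v y i) x = 0) (k : Fin d → ℤ) :
    ∑ l, Dx (iv k) l * cf (Vc v l) k = 0 := by
  have e : ∀ l, Dx (iv k) l * cf (Vc v l) k = cf (pdC l (Vc v l)) k := by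
    intro l
    rw [cf_pdC l (Vc_smooth hs l) (Vc_periodic hp l), Dx_iv]
  simp_rw [e]
  rw [← cf_sum _ (fun l => (pdC_smooth l (Vc_smooth hs l)).continuous)]
  have : (fun x => ∑ l, pdC l (Vc v l) x) = fun _ => 0 := by
    ext x
    have h1 : ∀ l, pdC l (Vc v l) x = ((pd l (fun z => v z l) x : ℝ) : ℂ) := fun l =>
      pdC_ofReal ((comp_smooth hs l).differentiable (by simp)) l x
    simp_rw [h1]
    rw [← Complex.ofReal_sum, hdiv]
    simp
  rw [this]
  simp [cf]

lemma pd_FS (hs : ContDiff ℝ (⊤ : ℕ∞) v) (hp : ZPeriodic v) (i j : Fin d) (x : Fin d → ℝ) :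
    pd j (fun y => v y i) x = (FS (fun k => Ds k j * cf (Vc v i) k) x).re := by
  rw [← pd_reFS (cf_RD (Vc_smooth hs i) (Vc_periodic hp i))]
  congr 1
  ext y
  rw [FS_cf (Vc_smooth hs i) (Vc_periodic hp i)]
  simp [Vc]

lemma R0_lap (K : Kers d) (hv : SmoothMeanZeroField d v)
    (hdiv : ∀ x, ∑ i, pd i (fun y => v y i) x = 0) (x : Fin d → ℝ) (i j : Fin d) :
    R0 K (lap v) x i j = pd j (fun y => v y i) x + pd i (fun y => v y j) x := by
  obtain ⟨hls, hlp, -⟩ := lap_SMZ hv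
  obtain ⟨hs, hp, -⟩ := hv
  rw [R0_FS K hls hlp, pd_FS hs hp, pd_FS hs hp, ← Complex.add_re]
  congr 1
  have hr : ∀ i j, RD (fun k => Ds k j * cf (Vc v i) k) := by
    intro i j
    have := (cf_RD (Vc_smooth hs i) (Vc_periodic hp i)).lf (Pi.single j 1)
    simpa [lf_single] using this
  unfold FS
  rw [← ((hr i j).summable x).tsum_add ((hr j i).summable x)]
  refine tsum_congr fun k => ?_
  unfold Ac
  simp_rw [cf_lap hs hp]
  rw [mm_lap i j (iv k) _ (cf_div hs hp hdiv k), Dx_iv, Dx_iv]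
  ring

lemma R0_smooth (K : Kers d) (hs : ContDiff ℝ (⊤ : ℕ∞) v) (hp : ZPeriodic v) :
    ContDiff ℝ (⊤ : ℕ∞) (R0 K v) := by
  refine contDiff_pi.2 fun i => contDiff_pi.2 fun j => ?_
  simp_rw [R0_FS K hs hp]
  exact Complex.reCLM.contDiff.comp (FS_contDiff (Ac_RD K hs hp i j))

lemma R0_periodic (K : Kers d) (hs : ContDiff ℝ (⊤ : ℕ∞) v) (hp : ZPeriodic v) :
    ZPeriodic (R0 K v) := by
  intro x k
  ext i j
  rw [R0_FS K hs hp, R0_FS K hs hp, FS_periodic _ x k]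

lemma R0_symm (K : Kers d) (hs : ContDiff ℝ (⊤ : ℕ∞) v) (hp : ZPeriodic v) (x : Fin d → ℝ)
    (i j : Fin d) : R0 K v x i j = R0 K v x j i := by
  rw [R0_FS K hs hp, R0_FS K hs hp]
  congr 2
  ext k
  unfold Ac
  simp_rw [mm_symm i j]

lemma R0_trace (K : Kers d) (hd : 2 ≤ d) (hs : ContDiff ℝ (⊤ : ℕ∞) v) (hp : ZPeriodic v)
    (x : Fin d → ℝ) : ∑ i, R0 K v x i i = 0 := by
  simp_rw [R0_FS K hs hp]
  rw [← Complex.re_sum, ← FS_sum _ (fun i => Ac_RD K hs hp i i)]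
  have : (fun k => ∑ i, Ac v i i k) = fun _ => 0 := by
    ext k
    unfold Ac
    rw [Finset.sum_comm]
    simp_rw [← Finset.sum_mul, mm_trace hd]
    simp
  rw [this]
  simp [FS]

lemma R0_div (K : Kers d) (hd : 2 ≤ d) (hv : SmoothMeanZeroField d v)
    (x : Fin d → ℝ) (i : Fin d) : ∑ j, pd j (fun y => R0 K v y i j) x = v x i := by
  obtain ⟨hs, hp, h0⟩ := hv
  simp_rw [R0_FS K hs hp]
  simp_rw [pd_reFS (Ac_RD K hs hp i _)]
  have hr : ∀ j, RD (fun k => Ds k j * Ac v i j k) := by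
    intro j
    have := (Ac_RD K hs hp i j).lf (Pi.single j 1)
    simpa [lf_single] using this
  rw [← Complex.re_sum, ← FS_sum _ hr]
  have : (fun k => ∑ j, Ds k j * Ac v i j k) = cf (Vc v i) := by
    ext k
    by_cases hk : k = 0
    · subst hk
      have : cf (Vc v i) 0 = ((∫ x in cube d, v x i : ℝ) : ℂ) := by
        rw [← integral_complex_ofReal]
        simp [cf, ee, Vc]
      rw [this, h0]
      simp [Ds]
    · have hk' : iv k ≠ 0 := by
        intro h
        have := one_le_norm_iv k hk
        rw [h] at this
        norm_num at this
      unfold Ac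
      simp_rw [Finset.mul_sum, ← mul_assoc, ← Dx_iv]
      rw [Finset.sum_comm]
      simp_rw [← Finset.sum_mul, mm_div hd i _ _ hk', mul_comm (kd i _)]
      exact sum_kd i _
  rw [this, FS_cf (Vc_smooth hs i) (Vc_periodic hp i)]
  simp [Vc]

lemma iv_smul (σ : ℕ) (k : Fin d → ℤ) : iv (fun j => (σ : ℤ) * k j) = (σ : ℝ) • iv k := by
  ext j; simp [iv]

lemma R0_scale (K : Kers d) (hs : ContDiff ℝ (⊤ : ℕ∞) v) (hp : ZPeriodic v)
    (σ : ℕ) (hσ : 0 < σ) (x : Fin d → ℝ) :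
    R0 K (fun x => v ((σ : ℝ) • x)) x = (σ : ℝ)⁻¹ • R0 K v ((σ : ℝ) • x) := by
  ext i j
  simp only [Pi.smul_apply, smul_eq_mul]
  unfold R0
  rw [← Complex.re_ofReal_mul, Finset.mul_sum]
  congr 1
  refine Finset.sum_congr rfl fun l _ => ?_
  rw [Op_FS K hs hp]
  have e : Vc (fun x => v ((σ : ℝ) • x)) l =
      fun y => ∑' k, cf (Vc v l) k * ee (fun j => (σ : ℤ) * k j) y := by
    ext y
    have := (FS_cf (Vc_smooth hs l) (Vc_periodic hp l) ((σ : ℝ) • y)).symm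
    unfold FS at this
    simp_rw [ee_smul] at this
    exact this
  rw [e, Op_tsum (K.hW i j l) (K.hY i j l) _
    (cf_RD (Vc_smooth hs l) (Vc_periodic hp l)).summable_norm]
  simp_rw [K.hm, iv_smul, mm_hom i j l σ (by exact_mod_cast hσ)]
  unfold FS
  rw [← tsum_mul_left]
  refine tsum_congr fun k => ?_
  rw [ee_smul]
  push_cast
  ring

lemma scale_SMZ (hv : SmoothMeanZeroField d v) (σ : ℕ) (hσ : 0 < σ) :
    SmoothMeanZeroField d (fun x => v ((σ : ℝ) • x)) := by
  obtain ⟨hs, hp, h0⟩ := hv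
  refine ⟨hs.comp (contDiff_const_smul _), ?_, fun i => ?_⟩
  · intro x k
    simp only
    rw [← hp ((σ : ℝ) • x) (fun i => σ * k i)]
    congr 1
    ext i
    simp
    ring
  · rw [← h0 i]
    exact int_scale (f := fun x => v x i) (comp_smooth hs i).continuous
      (fun x k => by simp only [hp x k]) σ hσ

/-- sum of the `L¹` norms of the kernels -/
def Kn (K : Kers d) : ℝ :=
  ∑ t : Fin d × Fin d × Fin d, ∫ ω, ‖K.W t.1 t.2.1 t.2.2 ω‖ ∂(kerMu d)

lemma Kn_nonneg (K : Kers d) : 0 ≤ Kn K :=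
  Finset.sum_nonneg fun t _ => integral_nonneg fun ω => norm_nonneg _

lemma R0_Lp (K : Kers d) (hs : ContDiff ℝ (⊤ : ℕ∞) v) (hp : ZPeriodic v) (p : ℝ≥0∞) (h1 : 1 ≤ p) :
    eLpNorm (R0 K v) p (volume.restrict (cube d))
      ≤ ENNReal.ofReal (Kn K) * eLpNorm v p (volume.restrict (cube d)) := by
  set g : (Fin d → ℝ) → ℝ := fun x => ‖v x‖ with hgdef
  have hg : Continuous g := hs.continuous.norm
  have hgp : ZPeriodic g := fun x k => by simp only [hgdef, hp x k]
  obtain ⟨C, hC⟩ := bdd_of_periodic hg hgp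
  let H : Fin d × Fin d × Fin d → (Fin d → ℝ) → ℝ := fun t x =>
    ∫ ω, ‖K.W t.1 t.2.1 t.2.2 ω‖ * ‖g (x - K.Y t.1 t.2.1 t.2.2 ω)‖ ∂(kerMu d)
  have hm : ∀ (t : Fin d × Fin d × Fin d) x, AEStronglyMeasurable
      (fun ω => ‖g (x - K.Y t.1 t.2.1 t.2.2 ω)‖) (kerMu d) := fun t x =>
    (hg.norm.measurable.comp (measurable_const.sub (K.hY _ _ _))).aestronglyMeasurable
  have hIntg : ∀ (t : Fin d × Fin d × Fin d) x, Integrable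
      (fun ω => ‖K.W t.1 t.2.1 t.2.2 ω‖ * ‖g (x - K.Y t.1 t.2.1 t.2.2 ω)‖) (kerMu d) := by
    intro t x
    refine (K.hW _ _ _).norm.mul_bdd (c := C) (hm t x) ?_
    filter_upwards with ω
    rw [norm_norm]
    exact hC _
  have hH0 : ∀ t x, 0 ≤ H t x := fun t x => integral_nonneg fun ω => by positivity
  have hHc : ∀ t, Continuous (H t) := by
    intro t
    refine continuous_of_dominated (bound := fun ω => ‖K.W t.1 t.2.1 t.2.2 ω‖ * C)
      (fun x => (hIntg t x).aestronglyMeasurable) (fun x => ?_) ((K.hW _ _ _).norm.mul_const C) ?_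
    · filter_upwards with ω
      rw [norm_mul, norm_norm, norm_norm]
      exact mul_le_mul_of_nonneg_left (hC _) (norm_nonneg _)
    · filter_upwards with ω
      exact continuous_const.mul (hg.norm.comp (continuous_id.sub continuous_const))
  have hpt : ∀ x, ‖R0 K v x‖ ≤ (∑ t, H t) x := by
    intro x
    have hS : 0 ≤ ∑ t, H t x := Finset.sum_nonneg fun t _ => hH0 t x
    rw [Finset.sum_apply, pi_norm_le_iff_of_nonneg hS]
    intro i
    rw [pi_norm_le_iff_of_nonneg hS]
    intro j
    have hl : ∀ l, ‖Op (K.W i j l) (K.Y i j l) (Vc v l) x‖ ≤ H (i, j, l) x := by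
      intro l
      refine norm_integral_le_of_norm_le (hIntg (i, j, l) x) ?_
      filter_upwards with ω
      rw [norm_mul]
      refine mul_le_mul_of_nonneg_left ?_ (norm_nonneg _)
      simp only [Vc, Complex.norm_real, hgdef, norm_norm]
      exact norm_le_pi_norm (v (x - K.Y i j l ω)) l
    calc ‖R0 K v x i j‖ ≤ ‖∑ l, Op (K.W i j l) (K.Y i j l) (Vc v l) x‖ := by
          exact Complex.abs_re_le_norm _
      _ ≤ ∑ l, H (i, j, l) x := norm_sum_le_of_le _ fun l _ => hl l
      _ ≤ ∑ t, H t x := by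
          rw [Fintype.sum_prod_type]
          have a1 := Finset.single_le_sum (f := fun i => ∑ y : Fin d × Fin d, H (i, y) x)
            (fun i _ => Finset.sum_nonneg fun t _ => hH0 _ x) (Finset.mem_univ i)
          refine le_trans ?_ a1
          simp only [Fintype.sum_prod_type]
          exact Finset.single_le_sum (f := fun j => ∑ l : Fin d, H (i, j, l) x)
            (fun i _ => Finset.sum_nonneg fun t _ => hH0 _ x) (Finset.mem_univ j)
  calc eLpNorm (R0 K v) p (volume.restrict (cube d))
      ≤ eLpNorm (∑ t, H t) p (volume.restrict (cube d)) := eLpNorm_mono_real hpt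
    _ ≤ ∑ t, eLpNorm (H t) p (volume.restrict (cube d)) :=
        eLpNorm_sum_le (fun t _ => (hHc t).aestronglyMeasurable) h1
    _ ≤ ∑ t : Fin d × Fin d × Fin d, ENNReal.ofReal (∫ ω, ‖K.W t.1 t.2.1 t.2.2 ω‖ ∂(kerMu d)) *
          eLpNorm g p (volume.restrict (cube d)) :=
        Finset.sum_le_sum fun t _ => ker_Lp (kerMu d) (K.hW _ _ _) (K.hY _ _ _) hg hgp p h1
    _ = ENNReal.ofReal (Kn K) * eLpNorm v p (volume.restrict (cube d)) := by
        rw [← Finset.sum_mul, Kn, ENNReal.ofReal_sum_of_nonneg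
          (fun t _ => integral_nonneg fun ω => norm_nonneg _), hgdef, eLpNorm_norm]

lemma Op_add {W : KerIdx d → ℂ} {Y : KerIdx d → Fin d → ℝ}
    (hW : Integrable W (kerMu d)) (hY : Measurable Y) {g h : (Fin d → ℝ) → ℂ}
    (hg : Continuous g) (hp : ZPeriodic g) (hh : Continuous h) (hhp : ZPeriodic h)
    (x : Fin d → ℝ) : Op W Y (fun y => g y + h y) x = Op W Y g x + Op W Y h x := by
  unfold Op
  rw [← integral_add (Op_integrable hW hY hg hp x) (Op_integrable hW hY hh hhp x)]
  simp_rw [mul_add]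

lemma R0_add (K : Kers d) {w : (Fin d → ℝ) → Fin d → ℝ} (hs : ContDiff ℝ (⊤ : ℕ∞) v)
    (hp : ZPeriodic v) (hs' : ContDiff ℝ (⊤ : ℕ∞) w) (hp' : ZPeriodic w) :
    R0 K (v + w) = R0 K v + R0 K w := by
  ext x i j
  simp only [Pi.add_apply, R0]
  rw [← Complex.add_re, ← Finset.sum_add_distrib]
  congr 1
  refine Finset.sum_congr rfl fun l _ => ?_
  rw [← Op_add (K.hW i j l) (K.hY i j l) (Vc_smooth hs l).continuous (Vc_periodic hp l)
    (Vc_smooth hs' l).continuous (Vc_periodic hp' l)]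
  congr 1
  ext y
  simp [Vc]

lemma R0_smul (K : Kers d) (c : ℝ) : R0 K (c • v) = c • R0 K v := by
  ext x i j
  simp only [Pi.smul_apply, smul_eq_mul, R0]
  rw [← Complex.re_ofReal_mul, Finset.mul_sum]
  congr 1
  refine Finset.sum_congr rfl fun l _ => ?_
  unfold Op
  rw [← integral_const_mul]
  congr 1
  ext ω
  simp [Vc]
  ring

/-- the space of smooth mean-zero fields -/
def SM (d : ℕ) : Submodule ℝ ((Fin d → ℝ) → Fin d → ℝ) where
  carrier := {v | SmoothMeanZeroField d v}
  add_mem' := by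
    rintro v w ⟨a1, a2, a3⟩ ⟨b1, b2, b3⟩
    refine ⟨a1.add b1, fun x k => ?_, fun i => ?_⟩
    · simp only [Pi.add_apply, a2 x k, b2 x k]
    · simp only [Pi.add_apply]
      rw [integral_add, a3, b3, add_zero]
      · exact (comp_smooth a1 i).continuous.continuousOn.integrableOn_compact (isCompact_cube d)
      · exact (comp_smooth b1 i).continuous.continuousOn.integrableOn_compact (isCompact_cube d)
  zero_mem' := by
    refine ⟨contDiff_const, fun x k => rfl, fun i => by simp⟩
  smul_mem' := by
    rintro c v ⟨a1, a2, a3⟩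
    refine ⟨contDiff_const.smul a1, fun x k => ?_, fun i => ?_⟩
    · simp only [Pi.smul_apply, a2 x k]
    · simp only [Pi.smul_apply, smul_eq_mul]
      rw [integral_const_mul, a3, mul_zero]

lemma exists_R (K : Kers d) : ∃ R : ((Fin d → ℝ) → Fin d → ℝ) →ₗ[ℝ] ((Fin d → ℝ) → Fin d → Fin d → ℝ),
    ∀ v, SmoothMeanZeroField d v → R v = R0 K v := by
  let L : SM d →ₗ[ℝ] ((Fin d → ℝ) → Fin d → Fin d → ℝ) :=
    { toFun := fun v => R0 K v.1
      map_add' := fun v w => R0_add K v.2.1 v.2.2.1 w.2.1 w.2.2.1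
      map_smul' := fun c v => R0_smul K c }
  obtain ⟨R, hR⟩ := LinearMap.exists_extend L
  refine ⟨R, fun v hv => ?_⟩
  exact congrArg (fun f => f ⟨v, hv⟩) hR
end basic

/-- **Anti-divergence operator on the torus.**
For `d ≥ 2` there is a linear operator `𝓡` mapping smooth mean-zero vector fields on
`𝕋^d` to smooth symmetric trace-free matrix fields such that `div(𝓡v) = v`,
`𝓡(Δv) = ∇v + (∇v)ᵀ` whenever `div v = 0`, `‖𝓡v‖_{L^p} ≤ C_p ‖v‖_{L^p}` for every
`p ∈ [1,∞]`, and `‖𝓡(f(σ·))‖_{L^p} ≤ C_p′ σ^{−1} ‖f‖_{L^p}` for every `σ ∈ ℕ`. -/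
theorem anti_divergence_operator (d : ℕ) (hd : 2 ≤ d) :
    ∃ R : ((Fin d → ℝ) → Fin d → ℝ) → ((Fin d → ℝ) → Fin d → Fin d → ℝ),
      -- `𝓡` is linear
      IsLinearMap ℝ R ∧
      -- `𝓡v` is a smooth symmetric trace-free matrix field on `𝕋^d` and (i) `div(𝓡v) = v`
      (∀ v, SmoothMeanZeroField d v →
        ContDiff ℝ (⊤ : ℕ∞) (R v) ∧ ZPeriodic (R v) ∧
        (∀ x i j, R v x i j = R v x j i) ∧
        (∀ x, ∑ i, R v x i i = 0) ∧
        (∀ x i, ∑ j, pd j (fun y => R v y i j) x = v x i)) ∧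
      -- (ii) if moreover `div v = 0` then `𝓡(Δv) = ∇v + (∇v)ᵀ`
      (∀ v, SmoothMeanZeroField d v → (∀ x, ∑ i, pd i (fun y => v y i) x = 0) →
        ∀ x i j, R (lap v) x i j
          = pd j (fun y => v y i) x + pd i (fun y => v y j) x) ∧
      -- (iii) `L^p` boundedness
      (∀ p : ℝ≥0∞, 1 ≤ p → ∃ C : ℝ, 0 < C ∧ ∀ v, SmoothMeanZeroField d v →
        eLpNorm (R v) p (volume.restrict (cube d))
          ≤ ENNReal.ofReal C * eLpNorm v p (volume.restrict (cube d))) ∧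
      -- (iv) gain from spatial oscillation
      (∀ p : ℝ≥0∞, 1 ≤ p → ∃ C : ℝ, 0 < C ∧ ∀ f, SmoothMeanZeroField d f →
        ∀ σ : ℕ, 0 < σ →
          eLpNorm (R (fun x => f ((σ : ℝ) • x))) p (volume.restrict (cube d))
            ≤ ENNReal.ofReal (C * (σ : ℝ)⁻¹) * eLpNorm f p (volume.restrict (cube d))) := by
  obtain ⟨W, Y, h1, h2, h3⟩ := exists_kers d
  let K : Kers d := ⟨W, Y, h1, h2, h3⟩
  obtain ⟨R, hR⟩ := exists_R K
  refine ⟨R, R.isLinear, ?_, ?_, ?_, ?_⟩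
  · intro v hv
    rw [hR v hv]
    exact ⟨R0_smooth K hv.1 hv.2.1, R0_periodic K hv.1 hv.2.1, R0_symm K hv.1 hv.2.1,
      R0_trace K hd hv.1 hv.2.1, R0_div K hd hv⟩
  · intro v hv hdiv
    rw [hR _ (lap_SMZ hv)]
    exact R0_lap K hv hdiv
  · intro p hp
    refine ⟨Kn K + 1, by linarith [Kn_nonneg K], fun v hv => ?_⟩
    rw [hR v hv]
    refine (R0_Lp K hv.1 hv.2.1 p hp).trans ?_
    gcongr
    linarith
  · intro p hp
    refine ⟨Kn K + 1, by linarith [Kn_nonneg K], fun f hf σ hσ => ?_⟩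
    rw [hR _ (scale_SMZ hf σ hσ)]
    have e : R0 K (fun x => f ((σ : ℝ) • x)) = (σ : ℝ)⁻¹ • fun x => R0 K f ((σ : ℝ) • x) := by
      ext1 x
      exact R0_scale K hf.1 hf.2.1 σ hσ x
    rw [e, eLpNorm_const_smul, eLp_scale (R0_smooth K hf.1 hf.2.1).continuous
      (R0_periodic K hf.1 hf.2.1) σ hσ p]
    have hs : ‖(σ : ℝ)⁻¹‖ₑ = ENNReal.ofReal (σ : ℝ)⁻¹ :=
      Real.enorm_of_nonneg (by positivity)
    rw [hs, mul_comm (Kn K + 1), ENNReal.ofReal_mul (by positivity), mul_assoc]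
    refine mul_le_mul_right ((R0_Lp K hf.1 hf.2.1 p hp).trans ?_) _
    gcongr
    linarith
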